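/- Let τ ∈ ℂ with Im τ > 0, q := e^{2πiτ}. Let u, v ∈ ℂ∖(ℤ+ℤτ), α ∈ ℂ, and set x := e^{2πiu}, y := e^{2πiv}, a := q^α. Assume none of x, y, x/a, y/a, xy/(aq) lies in q^ℤ := {q^m : m ∈ ℤ}. Then μ(x,y;a) = −i q^{−1/8} (x/y)^{α/2} · [(x;q)_∞ (y;q)_∞ (aq/x;q)_∞ (aq/y;q)_∞] / [(q;q)_∞ θ(y) θ(x/a) θ(xy/(aq))] · Σ_{n∈ℤ} (1 − (xy/a) q^{2n−1}) · ((x/a;q)_n (y/a;q)_n / ((x;q)_n (y;q)_n)) · q^{2n²−3n} (x²y²/a)^n, the bilateral sum being absolutely convergent. -/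

import Mathlib

noncomputable section

/-- `e z = exp(2πiz)`. -/
def e (z : ℂ) : ℂ := Complex.exp (2 * (Real.pi : ℂ) * Complex.I * z)

/-- Infinite q-Pochhammer symbol `(a;q)_∞`. -/
def qpinf (a q : ℂ) : ℂ := ∏' j : ℕ, (1 - a * q ^ j)

/-- `(a;q)_n` for `n : ℤ`, defined as `(a;q)_∞ / (a q^n;q)_∞`. -/
def qpint (a q : ℂ) (n : ℤ) : ℂ := qpinf a q / qpinf (a * q ^ n) q

/-- `θ(x) = (x;q)_∞ (q/x;q)_∞`. -/
def qtheta (q x : ℂ) : ℂ := qpinf x q * qpinf (q / x) q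

/-- Jacobi theta `ϑ₁₁(v) = -i q^{1/8} e^{-πiv} (q;q)_∞ θ(e^{2πiv})`. -/
def theta11 (τ v : ℂ) : ℂ :=
  -Complex.I * e (τ / 8) * e (-v / 2) * qpinf (e τ) (e τ) * qtheta (e τ) (e v)

/-- Generalized Zwegers μ-function `μ(u,v;α)`. -/
def genMu (τ u v α : ℂ) : ℂ :=
  e (α * (u - v) / 2) / theta11 τ v *
    ∑' n : ℤ, (-1 : ℂ) ^ n * e (((n : ℂ) + 1 / 2) * v) * (e τ) ^ ((n * (n + 1)) / 2) *
      (qpinf (e u * (e τ) ^ (n + 1)) (e τ) /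
       qpinf (e u * e (τ * ((n : ℂ) - α + 1))) (e τ))

/-- Finite q-Pochhammer symbol `(a;q)_k` for `k : ℕ`. -/
def qpfin (a q : ℂ) (k : ℕ) : ℂ := ∏ j ∈ Finset.range k, (1 - a * q ^ j)

lemma qpfin_zero (a q : ℂ) : qpfin a q 0 = 1 := by simp [qpfin]

lemma qpfin_succ (a q : ℂ) (k : ℕ) : qpfin a q (k + 1) = qpfin a q k * (1 - a * q ^ k) := by
  simp [qpfin, Finset.prod_range_succ]

lemma qpfin_succ' (a q : ℂ) (k : ℕ) :
    qpfin a q (k + 1) = (1 - a) * qpfin (a * q) q k := by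
  simp only [qpfin, Finset.prod_range_succ', pow_zero, mul_one]
  rw [mul_comm]
  congr 1
  refine Finset.prod_congr rfl fun j _ => ?_
  ring

lemma qpfin_shift (a q : ℂ) (k : ℕ) :
    qpfin a q k * (1 - a * q ^ k) = (1 - a) * qpfin (a * q) q k := by
  rw [← qpfin_succ, qpfin_succ']

lemma qpfin_ne_zero {a q : ℂ} (h : ∀ j : ℕ, 1 - a * q ^ j ≠ 0) (k : ℕ) : qpfin a q k ≠ 0 :=
  Finset.prod_ne_zero_iff.mpr fun j _ => h j

lemma qpfin_add (a q : ℂ) (n k : ℕ) :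
    qpfin a q (n + k) = qpfin a q n * qpfin (a * q ^ n) q k := by
  simp only [qpfin, Finset.prod_range_add]
  congr 1
  refine Finset.prod_congr rfl fun j _ => ?_
  ring

lemma summable_norm_mul_pow {q : ℂ} (hq : ‖q‖ < 1) (a : ℂ) :
    Summable fun j : ℕ => ‖-(a * q ^ j)‖ := by
  simp only [norm_neg, norm_mul, norm_pow]
  exact (summable_geometric_of_lt_one (norm_nonneg _) hq).mul_left _

lemma multipliable_one_sub_mul_pow {q : ℂ} (hq : ‖q‖ < 1) (a : ℂ) :
    Multipliable fun j : ℕ => (1 - a * q ^ j) := by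
  simpa [sub_eq_add_neg] using multipliable_one_add_of_summable (summable_norm_mul_pow hq a)

lemma tendsto_qpfin {q : ℂ} (hq : ‖q‖ < 1) (a : ℂ) :
    Filter.Tendsto (qpfin a q) Filter.atTop (nhds (qpinf a q)) :=
  (multipliable_one_sub_mul_pow hq a).tendsto_prod_tprod_nat

lemma qpinf_eq_qpfin_mul {q : ℂ} (hq : ‖q‖ < 1) (a : ℂ) (k : ℕ) :
    qpinf a q = qpfin a q k * qpinf (a * q ^ k) q := by
  refine tendsto_nhds_unique ((tendsto_qpfin hq a).comp (Filter.tendsto_add_atTop_nat k)) ?_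
  refine ((tendsto_qpfin hq (a * q ^ k)).const_mul (qpfin a q k)).congr fun n => ?_
  rw [Function.comp_apply, add_comm n k, qpfin_add]

lemma qpinf_eq_one_sub_mul {q : ℂ} (hq : ‖q‖ < 1) (a : ℂ) :
    qpinf a q = (1 - a) * qpinf (a * q) q := by
  simpa [qpfin_succ, qpfin_zero] using qpinf_eq_qpfin_mul hq a 1

lemma qpinf_ne_zero {a q : ℂ} (hq : ‖q‖ < 1) (h : ∀ j : ℕ, 1 - a * q ^ j ≠ 0) :
    qpinf a q ≠ 0 := by
  have := tprod_one_add_ne_zero_of_summable (f := fun j : ℕ => -(a * q ^ j))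
    (fun j => by simpa [sub_eq_add_neg] using h j) (summable_norm_mul_pow hq a)
  simpa [qpinf, sub_eq_add_neg] using this

lemma qpfin_bounded {q : ℂ} (hq : ‖q‖ < 1) (a : ℂ) : ∃ M, 0 < M ∧ ∀ k, ‖qpfin a q k‖ ≤ M := by
  obtain ⟨M, hM⟩ := (tendsto_qpfin hq a).norm.bddAbove_range
  exact ⟨max M 1, by positivity, fun k => (hM ⟨k, rfl⟩).trans (le_max_left _ _)⟩

lemma qpfin_inv_bounded {a q : ℂ} (hq : ‖q‖ < 1) (h : ∀ j : ℕ, 1 - a * q ^ j ≠ 0) :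
    ∃ M, 0 < M ∧ ∀ k, ‖(qpfin a q k)⁻¹‖ ≤ M := by
  obtain ⟨M, hM⟩ := ((tendsto_qpfin hq a).inv₀ (qpinf_ne_zero hq h)).norm.bddAbove_range
  exact ⟨max M 1, by positivity, fun k => (hM ⟨k, rfl⟩).trans (le_max_left _ _)⟩

lemma qpfin_shift_bounded {q : ℂ} (hq : ‖q‖ < 1) (a : ℂ) :
    ∃ M, 0 < M ∧ ∀ n k, ‖qpfin (a * q ^ n) q k‖ ≤ M := by
  obtain ⟨M, hM0, hM⟩ := qpfin_bounded (q := (‖q‖ : ℂ)) (by simpa using hq) (-‖a‖ : ℂ)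
  refine ⟨M, hM0, fun n k => le_trans ?_ (hM k)⟩
  simp only [qpfin, norm_prod]
  refine Finset.prod_le_prod (fun _ _ => norm_nonneg _) fun j _ => ?_
  have h1 : (1 - -(‖a‖ : ℂ) * (‖q‖ : ℂ) ^ j) = ((1 + ‖a‖ * ‖q‖ ^ j : ℝ) : ℂ) := by
    push_cast; ring
  rw [h1, Complex.norm_real, Real.norm_of_nonneg (by positivity)]
  refine (norm_sub_le _ _).trans ?_
  rw [norm_one, norm_mul, norm_mul, norm_pow, norm_pow]
  have : ‖q‖ ^ n ≤ 1 := pow_le_one₀ (norm_nonneg _) hq.le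
  have h2 : ‖a‖ * ‖q‖ ^ n ≤ ‖a‖ := mul_le_of_le_one_right (norm_nonneg _) this
  gcongr

lemma qpfin_shift_inv_bounded {a q : ℂ} (hq : ‖q‖ < 1) (h : ∀ j : ℕ, 1 - a * q ^ j ≠ 0) :
    ∃ M, 0 < M ∧ ∀ n k, ‖(qpfin (a * q ^ n) q k)⁻¹‖ ≤ M := by
  obtain ⟨M, hM0, hM⟩ := qpfin_bounded hq a
  obtain ⟨M', hM0', hM'⟩ := qpfin_inv_bounded hq h
  refine ⟨M * M', by positivity, fun n k => ?_⟩
  have h1 : (qpfin (a * q ^ n) q k)⁻¹ = qpfin a q n * (qpfin a q (n + k))⁻¹ := by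
    rw [qpfin_add, mul_inv, mul_inv_cancel_left₀ (qpfin_ne_zero h n)]
  rw [h1, norm_mul]
  exact mul_le_mul (hM n) (hM' _) (norm_nonneg _) hM0.le

lemma summable_pow_mul_pow_choose {s : ℝ} (h0 : 0 < s) (h1 : s < 1) (R : ℝ) (hR : 0 ≤ R) :
    Summable fun k : ℕ => R ^ k * s ^ k.choose 2 := by
  rcases hR.eq_or_lt with rfl | hR
  · refine summable_of_ne_finset_zero (s := {0}) fun k hk => ?_
    have : k ≠ 0 := by simpa using hk
    simp [this]
  refine summable_of_ratio_test_tendsto_lt_one (l := 0) one_pos ?_ ?_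
  · exact Filter.Eventually.of_forall fun k => by positivity
  · have h := (tendsto_pow_atTop_nhds_zero_of_lt_one h0.le h1).const_mul R
    rw [mul_zero] at h
    refine h.congr fun k => ?_
    have hc : (k + 1).choose 2 = k.choose 2 + k := by
      rw [Nat.choose_succ_succ' k 1, Nat.choose_one_right, add_comm]
    rw [Real.norm_of_nonneg (by positivity), Real.norm_of_nonneg (by positivity), hc]
    field_simp
    ring

lemma tendsto_mul_pow_zero {q : ℂ} (hq : ‖q‖ < 1) (a : ℂ) :
    Filter.Tendsto (fun n : ℕ => a * q ^ n) Filter.atTop (nhds 0) := by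
  simpa using (tendsto_pow_atTop_nhds_zero_of_norm_lt_one hq).const_mul a

lemma tendsto_qpfin_shift {q : ℂ} (hq : ‖q‖ < 1) (a : ℂ) (k : ℕ) :
    Filter.Tendsto (fun n : ℕ => qpfin (a * q ^ n) q k) Filter.atTop (nhds 1) := by
  have : Filter.Tendsto (fun n : ℕ => ∏ j ∈ Finset.range k, (1 - a * q ^ n * q ^ j))
      Filter.atTop (nhds (∏ j ∈ Finset.range k, (1 - 0 * q ^ j))) :=
    tendsto_finsetProd _ fun j _ => ((tendsto_mul_pow_zero hq a).mul_const _).const_sub 1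
  simpa [qpfin] using this

lemma eq_div_of_qshift_recurrence {q a b : ℂ} (hq : ‖q‖ < 1) (hb : ∀ j : ℕ, 1 - b * q ^ j ≠ 0)
    (F : ℕ → ℂ) (hF : ∀ n, (1 - b * q ^ n) * F n = (1 - a * q ^ n) * F (n + 1))
    (hlim : Filter.Tendsto F Filter.atTop (nhds 1)) : F 0 = qpinf a q / qpinf b q := by
  have key : ∀ n, qpfin b q n * F 0 = qpfin a q n * F n := by
    intro n
    induction n with
    | zero => simp [qpfin_zero]
    | succ n ih =>
      rw [qpfin_succ, qpfin_succ]
      linear_combination (1 - b * q ^ n) * ih + qpfin a q n * hF n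
  rw [eq_div_iff (qpinf_ne_zero hq hb), mul_comm]
  refine tendsto_nhds_unique ((tendsto_qpfin hq b).mul_const (F 0)) ?_
  simpa [key] using (tendsto_qpfin hq a).mul hlim

lemma tsum_sub_tsum_succ {G : ℕ → ℂ} (hG : Summable G) (h0 : G 0 = 0) :
    ∑' k, (G k - G (k + 1)) = 0 := by
  rw [hG.tsum_sub ((summable_nat_add_iff 1).mpr hG), hG.tsum_eq_zero_add, h0]
  ring

lemma norm_one_sub_pow_le {q : ℂ} (hq : ‖q‖ < 1) (k : ℕ) : ‖1 - q ^ k‖ ≤ 2 := by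
  refine (norm_sub_le _ _).trans ?_
  rw [norm_one, norm_pow]
  linarith [pow_le_one₀ (norm_nonneg q) hq.le (n := k)]

lemma one_sub_mul_pow_self_ne_zero {q : ℂ} (hq : ‖q‖ < 1) (j : ℕ) : 1 - q * q ^ j ≠ 0 := by
  rw [← pow_succ']
  intro h
  have h1 : ‖q ^ (j + 1)‖ = 1 := by rw [← sub_eq_zero.mp h, norm_one]
  rw [norm_pow] at h1
  exact absurd h1 (pow_lt_one₀ (norm_nonneg q) hq (Nat.succ_ne_zero j)).ne

lemma succ_choose_two (k : ℕ) : (k + 1).choose 2 = k.choose 2 + k := by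
  rw [Nat.choose_succ_succ' k 1, Nat.choose_one_right, add_comm]

lemma one_sub_shift_ne_zero {a q : ℂ} (h : ∀ j : ℕ, 1 - a * q ^ j ≠ 0) (n j : ℕ) :
    1 - a * q ^ n * q ^ j ≠ 0 := by
  rw [mul_assoc, ← pow_add]
  exact h _

/-- Summand of the confluent q-Gauss series. -/
def gaussTerm (q e w : ℂ) (k : ℕ) : ℂ :=
  qpfin e q k / (qpfin q q k * qpfin (e * w) q k) * (-w) ^ k * q ^ k.choose 2

lemma exists_gaussTerm_bound {q e w : ℂ} (hq0 : q ≠ 0) (hq : ‖q‖ < 1)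
    (h : ∀ j : ℕ, 1 - e * w * q ^ j ≠ 0) :
    ∃ b : ℕ → ℝ, Summable b ∧ ∀ n k, ‖gaussTerm q e (w * q ^ n) k‖ ≤ b k := by
  obtain ⟨M₁, hM₁, h₁⟩ := qpfin_bounded hq e
  obtain ⟨M₂, hM₂, h₂⟩ := qpfin_inv_bounded hq (one_sub_mul_pow_self_ne_zero hq)
  obtain ⟨M₃, hM₃, h₃⟩ := qpfin_shift_inv_bounded hq h
  refine ⟨fun k => M₁ * (M₂ * M₃) * (‖w‖ ^ k * ‖q‖ ^ k.choose 2),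
    (summable_pow_mul_pow_choose (norm_pos_iff.mpr hq0) hq _ (norm_nonneg w)).mul_left _,
    fun n k => ?_⟩
  have hw : ‖w * q ^ n‖ ≤ ‖w‖ := by
    rw [norm_mul, norm_pow]
    exact mul_le_of_le_one_right (norm_nonneg _) (pow_le_one₀ (norm_nonneg _) hq.le)
  rw [gaussTerm, div_eq_mul_inv, mul_inv, mul_assoc _ ((-(w * q ^ n)) ^ k), norm_mul, norm_mul,
    norm_mul, norm_mul, norm_pow, norm_pow, norm_neg, ← mul_assoc e]
  beta_reduce
  gcongr
  exacts [h₁ k, h₂ k, h₃ n k]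

lemma hasSum_gaussTerm {q e w : ℂ} (hq0 : q ≠ 0) (hq : ‖q‖ < 1)
    (h : ∀ j : ℕ, 1 - e * w * q ^ j ≠ 0) :
    HasSum (gaussTerm q e w) (qpinf w q / qpinf (e * w) q) := by
  obtain ⟨b, hb, hbound⟩ := exists_gaussTerm_bound hq0 hq h
  have hsum : ∀ n, Summable (gaussTerm q e (w * q ^ n)) := fun n =>
    Summable.of_norm_bounded hb (hbound n)
  have hF := eq_div_of_qshift_recurrence (a := w) hq h
    (fun n => ∑' k, gaussTerm q e (w * q ^ n) k) ?_ ?_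
  · have h0 := hsum 0
    simp only [pow_zero, mul_one] at hF h0
    rw [← hF]
    exact h0.hasSum
  · intro n
    have hG : Summable fun k =>
        (1 - e * w * q ^ n) * ((1 - q ^ k) * gaussTerm q e (w * q ^ n) k) := by
      refine Summable.mul_left _ (Summable.of_norm_bounded (hb.mul_left 2) fun k => ?_)
      rw [norm_mul]
      exact mul_le_mul (norm_one_sub_pow_le hq k) (hbound n k) (norm_nonneg _) zero_le_two
    have h0 := tsum_sub_tsum_succ hG (by simp)
    rw [← sub_eq_zero, ← tsum_mul_left, ← tsum_mul_left,
      ← ((hsum n).mul_left _).tsum_sub ((hsum (n + 1)).mul_left _), ← h0]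
    refine tsum_congr fun k => ?_
    have e1 := one_sub_shift_ne_zero h n
    have e2 := qpfin_ne_zero e1 k
    have e3 := qpfin_ne_zero (one_sub_mul_pow_self_ne_zero hq) k
    have e5 := one_sub_mul_pow_self_ne_zero hq k
    have e6 := e1 k
    have e7 : 1 - e * w * q ^ n ≠ 0 := h n
    have hs := qpfin_shift (e * w * q ^ n) q k
    have hs' : qpfin (e * w * q ^ n * q) q k =
        qpfin (e * w * q ^ n) q k * (1 - e * w * q ^ n * q ^ k) / (1 - e * w * q ^ n) := by
      rw [eq_div_iff e7, hs]; ring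
    simp only [gaussTerm, qpfin_succ, succ_choose_two, pow_add, pow_one, ← mul_assoc]
    rw [hs']
    generalize q ^ n = Qn at *
    have e8 : q ^ k ≠ 0 := pow_ne_zero _ hq0
    rw [show (-(w * Qn * q)) ^ k = (-(w * Qn)) ^ k * q ^ k by rw [← mul_pow]; ring]
    generalize q ^ k = Q at *
    rw [mul_comm Q q]
    generalize hD : 1 - q * Q = D at *
    field_simp
    ring
  · have := tendsto_tsum_of_dominated_convergence (𝓕 := Filter.atTop)
      (f := fun n k => gaussTerm q e (w * q ^ n) k) (g := fun k => if k = 0 then 1 else 0) hb ?_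
      (Filter.Eventually.of_forall hbound)
    · simpa using this
    · intro k
      have t1 := (tendsto_qpfin_shift hq (e * w) k).const_mul (qpfin q q k)
      have t2 := (tendsto_mul_pow_zero hq w).neg.pow k
      have t3 := (((tendsto_const_nhds (x := qpfin e q k)).div t1 (by
        simpa using qpfin_ne_zero (one_sub_mul_pow_self_ne_zero hq) k)).mul t2).mul_const
          (q ^ k.choose 2)
      refine (t3.congr fun n => ?_).trans (le_of_eq ?_)
      · simp only [gaussTerm, Pi.div_apply, ← mul_assoc]
      · rcases eq_or_ne k 0 with rfl | hk
        · simp [qpfin_zero]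
        · simp [hk]

/-- Summand of the confluent very-well-poised `₆φ₅` series with base `c * b`, without its
very-well-poised factor. -/
def wellPoisedTerm (q c b : ℂ) (k : ℕ) : ℂ :=
  qpfin (c * b) q k * qpfin c q k / (qpfin q q k * qpfin (b * q) q k) * (b * q) ^ k *
    (q ^ k.choose 2) ^ 2

lemma exists_wellPoisedTerm_bound {q c b : ℂ} (hq0 : q ≠ 0) (hq : ‖q‖ < 1)
    (h : ∀ j : ℕ, 1 - b * q * q ^ j ≠ 0) :
    ∃ B : ℕ → ℝ, Summable B ∧ ∀ n k, ‖wellPoisedTerm q c (b * q ^ n) k‖ ≤ B k := by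
  obtain ⟨M₀, hM₀, h₀⟩ := qpfin_shift_bounded hq (c * b)
  obtain ⟨M₁, hM₁, h₁⟩ := qpfin_bounded hq c
  obtain ⟨M₂, hM₂, h₂⟩ := qpfin_inv_bounded hq (one_sub_mul_pow_self_ne_zero hq)
  obtain ⟨M₃, hM₃, h₃⟩ := qpfin_shift_inv_bounded hq h
  refine ⟨fun k => M₀ * M₁ * (M₂ * M₃) * (‖b * q‖ ^ k * ‖q‖ ^ k.choose 2),
    (summable_pow_mul_pow_choose (norm_pos_iff.mpr hq0) hq _ (norm_nonneg _)).mul_left _,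
    fun n k => ?_⟩
  have hw : ‖b * q ^ n * q‖ ≤ ‖b * q‖ := by
    rw [mul_right_comm, norm_mul, norm_pow]
    exact mul_le_of_le_one_right (norm_nonneg _) (pow_le_one₀ (norm_nonneg _) hq.le)
  have h2 : (‖q‖ ^ k.choose 2) ^ 2 ≤ ‖q‖ ^ k.choose 2 :=
    pow_le_of_le_one (by positivity) (pow_le_one₀ (norm_nonneg _) hq.le) two_ne_zero
  rw [wellPoisedTerm, div_eq_mul_inv, mul_inv, mul_assoc _ ((b * q ^ n * q) ^ k), norm_mul,
    norm_mul, norm_mul, norm_mul, norm_mul, norm_pow, norm_pow, norm_pow, ← mul_assoc c,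
    show b * q ^ n * q = b * q * q ^ n by ring]
  rw [show b * q ^ n * q = b * q * q ^ n by ring] at hw
  beta_reduce
  gcongr
  exacts [h₀ n k, h₁ k, h₂ k, h₃ n k]

lemma hasSum_wellPoisedTerm {q c b : ℂ} (hq0 : q ≠ 0) (hq : ‖q‖ < 1)
    (h : ∀ j : ℕ, 1 - b * q * q ^ j ≠ 0) :
    HasSum (fun k => (1 - c * b * q ^ (2 * k)) * wellPoisedTerm q c b k)
      (qpinf (c * b) q / qpinf (b * q) q) := by
  obtain ⟨B, hB, hbound⟩ := exists_wellPoisedTerm_bound (c := c) hq0 hq h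
  have hbound' : ∀ n k, ‖(1 - c * (b * q ^ n) * q ^ (2 * k)) * wellPoisedTerm q c (b * q ^ n) k‖ ≤
      (1 + ‖c * b‖) * B k := by
    intro n k
    rw [norm_mul]
    refine mul_le_mul ?_ (hbound n k) (norm_nonneg _) (by positivity)
    refine (norm_sub_le _ _).trans ?_
    rw [norm_one, ← mul_assoc, mul_assoc (c * b), ← pow_add, norm_mul, norm_pow]
    gcongr
    exact mul_le_of_le_one_right (norm_nonneg _) (pow_le_one₀ (norm_nonneg _) hq.le)
  have hsum : ∀ n, Summable
      (fun k => (1 - c * (b * q ^ n) * q ^ (2 * k)) * wellPoisedTerm q c (b * q ^ n) k) := fun n =>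
    Summable.of_norm_bounded (hB.mul_left _) (hbound' n)
  have hF := eq_div_of_qshift_recurrence (a := c * b) hq h
    (fun n => ∑' k, (1 - c * (b * q ^ n) * q ^ (2 * k)) * wellPoisedTerm q c (b * q ^ n) k) ?_ ?_
  · have h0 := hsum 0
    simp only [pow_zero, mul_one] at hF h0
    rw [← hF]
    exact h0.hasSum
  · intro n
    have hG : Summable fun k =>
        (1 - b * q * q ^ n) * ((1 - q ^ k) * wellPoisedTerm q c (b * q ^ n) k) := by
      refine Summable.mul_left _ (Summable.of_norm_bounded (hB.mul_left 2) fun k => ?_)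
      rw [norm_mul]
      exact mul_le_mul (norm_one_sub_pow_le hq k) (hbound n k) (norm_nonneg _) zero_le_two
    have h0 := tsum_sub_tsum_succ hG (by simp)
    rw [← sub_eq_zero, ← tsum_mul_left, ← tsum_mul_left,
      ← ((hsum n).mul_left _).tsum_sub ((hsum (n + 1)).mul_left _), ← h0]
    refine tsum_congr fun k => ?_
    have e1 := one_sub_shift_ne_zero h n
    have e2 := qpfin_ne_zero e1 k
    have e3 := qpfin_ne_zero (one_sub_mul_pow_self_ne_zero hq) k
    have e5 := one_sub_mul_pow_self_ne_zero hq k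
    have e6 := e1 k
    have e7 : 1 - b * q * q ^ n ≠ 0 := h n
    have hs := qpfin_shift (b * q * q ^ n) q k
    have hs' : qpfin (b * q * q ^ n * q) q k =
        qpfin (b * q * q ^ n) q k * (1 - b * q * q ^ n * q ^ k) / (1 - b * q * q ^ n) := by
      rw [eq_div_iff e7, hs]; ring
    have hc := qpfin_shift (c * b * q ^ n) q k
    rw [mul_right_comm (c * b) (q ^ n) q] at hc
    have e8 : q ^ k ≠ 0 := pow_ne_zero _ hq0
    simp only [wellPoisedTerm, qpfin_succ, succ_choose_two, pow_add, pow_one, ← mul_assoc,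
      show b * q ^ n * q = b * q * q ^ n by ring, two_mul,
      show (b * q * q ^ n * q) ^ k = (b * q * q ^ n) ^ k * q ^ k by rw [← mul_pow]]
    rw [hs']
    generalize q ^ n = Qn at *
    generalize q ^ k = Q at *
    rw [mul_comm Q q]
    generalize qpfin (c * b * Qn) q k = X at *
    generalize qpfin (c * b * q * Qn) q k = X' at *
    field_simp
    linear_combination qpfin c q k * (b * q * Qn) ^ k * Q * (1 - b * q * Qn * c * Q ^ 2) * hc
  · have := tendsto_tsum_of_dominated_convergence (𝓕 := Filter.atTop)
      (f := fun n k => (1 - c * (b * q ^ n) * q ^ (2 * k)) * wellPoisedTerm q c (b * q ^ n) k)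
      (g := fun k => if k = 0 then 1 else 0) (hB.mul_left _) ?_
      (Filter.Eventually.of_forall hbound')
    · simpa using this
    · intro k
      have t0 := (((tendsto_mul_pow_zero hq (c * b)).mul_const (q ^ (2 * k))).const_sub 1)
      have t1 := (tendsto_qpfin_shift hq (b * q) k).const_mul (qpfin q q k)
      have t2 := (tendsto_mul_pow_zero hq (b * q)).pow k
      have t4 := (tendsto_qpfin_shift hq (c * b) k).mul_const (qpfin c q k)
      have t3 := t0.mul (((t4.div t1 (by
        simpa using qpfin_ne_zero (one_sub_mul_pow_self_ne_zero hq) k)).mul t2).mul_const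
          ((q ^ k.choose 2) ^ 2))
      refine (t3.congr fun n => ?_).trans (le_of_eq ?_)
      · simp only [wellPoisedTerm, Pi.div_apply, ← mul_assoc,
          show b * q ^ n * q = b * q * q ^ n by ring]
      · rcases eq_or_ne k 0 with rfl | hk
        · simp [qpfin_zero]
        · simp [hk]

lemma e_add (z w : ℂ) : e (z + w) = e z * e w := by
  rw [e, e, e, ← Complex.exp_add]; ring_nf

lemma e_zero : e 0 = 1 := by simp [e]

lemma e_neg (z : ℂ) : e (-z) = (e z)⁻¹ := by
  rw [e, e, ← Complex.exp_neg]; ring_nf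

lemma e_sub (z w : ℂ) : e (z - w) = e z / e w := by
  rw [sub_eq_add_neg, e_add, e_neg, div_eq_mul_inv]

lemma e_ne_zero (z : ℂ) : e z ≠ 0 := Complex.exp_ne_zero _

lemma e_zpow (z : ℂ) (n : ℤ) : e z ^ n = e (n * z) := by
  rw [e, e, ← Complex.exp_int_mul]; ring_nf

lemma e_pow (z : ℂ) (n : ℕ) : e z ^ n = e (n * z) := by
  rw [e, e, ← Complex.exp_nat_mul]; ring_nf

lemma e_half : e (1 / 2) = -1 := by
  rw [e, ← Complex.exp_pi_mul_I]; ring_nf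

lemma neg_one_zpow_eq_e (n : ℤ) : (-1 : ℂ) ^ n = e (n / 2) := by
  rw [← e_half, e_zpow]; ring_nf

lemma neg_e (z : ℂ) : -e z = e (1 / 2 + z) := by
  rw [e_add, e_half]; ring

lemma norm_e (z : ℂ) : ‖e z‖ = Real.exp (-(2 * Real.pi) * z.im) := by
  rw [e, Complex.norm_exp]
  congr 1
  simp [Complex.mul_re, Complex.mul_im]

lemma norm_e_lt_one {τ : ℂ} (hτ : 0 < τ.im) : ‖e τ‖ < 1 := by
  rw [norm_e, Real.exp_lt_one_iff]
  nlinarith [Real.pi_pos]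

lemma e_int (m : ℤ) : e m = 1 := by
  rw [e, Complex.exp_eq_one_iff]
  exact ⟨m, by ring⟩

/-- `(e z; e τ)_∞` in additive notation. -/
def qpe (τ z : ℂ) : ℂ := qpinf (e z) (e τ)

/-- The theta function `θ(e z)` in additive notation. -/
def thetae (τ z : ℂ) : ℂ := qpe τ z * qpe τ (τ - z)

/-- `e z` is not an integral power of `e τ`. -/
def OffLattice (τ z : ℂ) : Prop := ∀ n : ℤ, e (z + n * τ) ≠ 1

lemma OffLattice.neg {τ z : ℂ} (h : OffLattice τ z) : OffLattice τ (-z) := fun n hn => by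
  refine h (-n) ?_
  rw [show z + ((-n : ℤ) : ℂ) * τ = -(-z + n * τ) by push_cast; ring, e_neg, hn, inv_one]

lemma OffLattice.add_int_mul {τ z : ℂ} (h : OffLattice τ z) (m : ℤ) :
    OffLattice τ (z + m * τ) := fun n hn => by
  refine h (m + n) ?_
  rw [← hn]
  congr 1
  push_cast; ring

lemma OffLattice.one_sub_ne_zero {τ z : ℂ} (h : OffLattice τ z) (j : ℕ) :
    1 - e z * e τ ^ j ≠ 0 := by
  rw [e_pow, ← e_add, sub_ne_zero]
  exact fun hj => h j (by simpa using hj.symm)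

lemma OffLattice.qpe_ne_zero {τ z : ℂ} (hτ : 0 < τ.im) (h : OffLattice τ z) : qpe τ z ≠ 0 :=
  qpinf_ne_zero (norm_e_lt_one hτ) h.one_sub_ne_zero

lemma OffLattice.thetae_ne_zero {τ z : ℂ} (hτ : 0 < τ.im) (h : OffLattice τ z) :
    thetae τ z ≠ 0 := by
  refine mul_ne_zero (h.qpe_ne_zero hτ) (OffLattice.qpe_ne_zero hτ ?_)
  have := h.neg.add_int_mul 1
  rwa [show -z + ((1 : ℤ) : ℂ) * τ = τ - z by push_cast; ring] at this

lemma qpe_eq_one_sub_mul {τ : ℂ} (hτ : 0 < τ.im) (z : ℂ) :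
    qpe τ z = (1 - e z) * qpe τ (z + τ) := by
  rw [qpe, qpinf_eq_one_sub_mul (norm_e_lt_one hτ), qpe, e_add]

lemma qpe_eq_qpfin_mul {τ : ℂ} (hτ : 0 < τ.im) (z : ℂ) (k : ℕ) :
    qpe τ z = qpfin (e z) (e τ) k * qpe τ (z + k * τ) := by
  rw [qpe, qpinf_eq_qpfin_mul (norm_e_lt_one hτ) _ k, qpe, e_add, e_pow]

lemma thetae_add {τ : ℂ} (hτ : 0 < τ.im) (z : ℂ) :
    thetae τ (z + τ) = e (1 / 2 - z) * thetae τ z := by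
  have h1 := qpe_eq_one_sub_mul hτ z
  have h2 := qpe_eq_one_sub_mul hτ (-z)
  rw [show -z + τ = τ - z by ring] at h2
  rw [thetae, thetae, show τ - (z + τ) = -z by ring, h1, h2, e_sub, e_half, e_neg]
  have := e_ne_zero z
  field_simp
  ring

lemma thetae_add_int_mul {τ : ℂ} (hτ : 0 < τ.im) (z : ℂ) (n : ℤ) :
    thetae τ (z + n * τ) = e (n / 2 - n * z - n * (n - 1) / 2 * τ) * thetae τ z := by
  induction n using Int.induction_on with
  | zero => simp [e_zero]
  | succ n ih =>
    rw [show z + ((n + 1 : ℤ) : ℂ) * τ = z + ((n : ℤ) : ℂ) * τ + τ by push_cast; ring,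
      thetae_add hτ, ih, ← mul_assoc, ← e_add]
    congr 2
    push_cast; ring
  | pred n ih =>
    have h := thetae_add hτ (z + ((-n - 1 : ℤ) : ℂ) * τ)
    rw [show z + ((-n - 1 : ℤ) : ℂ) * τ + τ = z + ((-n : ℤ) : ℂ) * τ by push_cast; ring, ih] at h
    refine mul_left_cancel₀ (e_ne_zero _) (h.symm.trans ?_)
    rw [← mul_assoc, ← e_add]
    congr 2
    push_cast; ring

lemma exists_qpe_bound_nat {τ : ℂ} (hτ : 0 < τ.im) (z : ℂ) :
    ∃ M, 1 ≤ M ∧ ∀ n : ℕ, ‖qpe τ (z + n * τ)‖ ≤ M := by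
  have hq := norm_e_lt_one hτ
  obtain ⟨M, -, hM⟩ := qpfin_shift_bounded hq (e z)
  refine ⟨max M 1, le_max_right _ _, fun n => ?_⟩
  rw [qpe, e_add, ← e_pow]
  exact (le_of_tendsto (tendsto_qpfin hq _).norm (Filter.Eventually.of_forall (hM n))).trans
    (le_max_left _ _)

lemma norm_qpe_sub_nat_mul_le {τ : ℂ} (hτ : 0 < τ.im) (z : ℂ) (m : ℕ) :
    ‖qpe τ (z - m * τ)‖ ≤ ‖qpe τ z‖ *
      Real.exp (m * Real.log (1 + ‖e z‖) + 2 * Real.pi * τ.im * (m * (m + 1) / 2)) := by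
  induction m with
  | zero => simp
  | succ m ih =>
    have hc := mul_pos Real.two_pi_pos hτ
    rw [qpe_eq_one_sub_mul hτ, show z - ((m + 1 : ℕ) : ℂ) * τ + τ = z - m * τ by push_cast; ring,
      norm_mul]
    have h1 : ‖1 - e (z - ((m + 1 : ℕ) : ℂ) * τ)‖ ≤
        Real.exp (Real.log (1 + ‖e z‖) + 2 * Real.pi * τ.im * (m + 1)) := by
      have h2 : ‖e (z - ((m + 1 : ℕ) : ℂ) * τ)‖ =
          ‖e z‖ * Real.exp (2 * Real.pi * τ.im * (m + 1)) := by
        rw [norm_e, norm_e, ← Real.exp_add]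
        congr 1
        simp only [Complex.sub_im, Complex.mul_im, Complex.natCast_re, Complex.natCast_im]
        push_cast; ring
      have h3 : 1 ≤ Real.exp (2 * Real.pi * τ.im * (m + 1)) :=
        Real.one_le_exp (by positivity)
      refine (norm_sub_le _ _).trans ?_
      rw [h2, norm_one, Real.exp_add, Real.exp_log (by positivity)]
      linarith
    refine (mul_le_mul h1 ih (norm_nonneg _) (Real.exp_nonneg _)).trans (le_of_eq ?_)
    rw [mul_left_comm, ← Real.exp_add]
    congr 2
    push_cast; ring

lemma exists_qpe_bound {τ : ℂ} (hτ : 0 < τ.im) (z : ℂ) :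
    ∃ C : ℝ, 0 ≤ C ∧ ∀ n : ℤ, ‖qpe τ (z + n * τ)‖ ≤
      Real.exp (C * (1 + |(n : ℝ)|) + 2 * Real.pi * τ.im * ((min (n : ℝ) 0) ^ 2 / 2)) := by
  obtain ⟨M, hM1, hM⟩ := exists_qpe_bound_nat hτ z
  have hM0 : 0 < M := by linarith
  have hl : 0 ≤ Real.log (1 + ‖e z‖) := Real.log_nonneg (by linarith [norm_nonneg (e z)])
  have hc := mul_pos Real.two_pi_pos hτ
  have hlM := Real.log_nonneg hM1
  refine ⟨Real.log M + Real.log (1 + ‖e z‖) + 2 * Real.pi * τ.im, by positivity, fun n => ?_⟩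
  obtain ⟨m, rfl | rfl⟩ := n.eq_nat_or_neg
  · refine (by simpa using hM m : _ ≤ M).trans ?_
    rw [← Real.exp_log hM0, Real.exp_le_exp, Real.exp_log hM0]
    have h0 : (0 : ℝ) ≤ |((m : ℤ) : ℝ)| := abs_nonneg _
    have h1 : 0 ≤ 2 * Real.pi * τ.im * ((min ((m : ℤ) : ℝ) 0) ^ 2 / 2) := by positivity
    nlinarith [mul_nonneg hlM h0, mul_nonneg hl h0, mul_nonneg hc.le h0]
  · have h1 := norm_qpe_sub_nat_mul_le hτ z m
    rw [show z - m * τ = z + ((-m : ℤ) : ℂ) * τ by push_cast; ring] at h1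
    refine h1.trans ?_
    have h2 : ‖qpe τ z‖ ≤ Real.exp (Real.log M) := by
      rw [Real.exp_log hM0]; simpa using hM 0
    refine (mul_le_mul_of_nonneg_right h2 (Real.exp_nonneg _)).trans ?_
    rw [← Real.exp_add, Real.exp_le_exp]
    have h0 : (0 : ℝ) ≤ m := Nat.cast_nonneg m
    push_cast
    rw [min_eq_left (by linarith), abs_neg, abs_of_nonneg h0]
    nlinarith [mul_nonneg hlM h0, mul_nonneg hl h0, mul_nonneg hc.le h0]

/-- Summand of the double series which interpolates between the two bilateral series. -/
def doubleTerm (τ u v β : ℂ) (r : ℤ) (k : ℕ) : ℂ :=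
  (1 - e (u + v - β - τ + 2 * r * τ)) *
    e (2 * r * (u + v - β - τ) + r * (2 * r - 1) * τ + ((r + k) / 2 + (r + k) * v +
      (r + k) * (r + k - 1) / 2 * τ)) *
    qpe τ (u + r * τ) * qpe τ (β - v + (1 - r) * τ) *
    qpe τ (u + v - β - τ + (2 * r + 1 + k) * τ) /
    (thetae τ (u + v - β - τ) * qpe τ (u - β + (r + k) * τ) * qpfin (e τ) (e τ) k)

/-- Summand of the very-well-poised bilateral series. -/
def rowTerm (τ u v β : ℂ) (r : ℤ) : ℂ :=
  (1 - e (u + v - β - τ + 2 * r * τ)) *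
    e (2 * r * (u + v - β - τ) + r * (2 * r - 1) * τ + (r / 2 + r * v + r * (r - 1) / 2 * τ)) *
    qpe τ (u + r * τ) * qpe τ (β - v + (1 - r) * τ) * qpe τ (v + r * τ) /
    (thetae τ (u + v - β - τ) * qpe τ (u - β + r * τ))

/-- Summand of the bilateral series defining `genMu`. -/
def columnTerm (τ u v β : ℂ) (n : ℤ) : ℂ :=
  e (n / 2 + n * v + n * (n - 1) / 2 * τ) * qpe τ (u + n * τ) / qpe τ (u - β + n * τ)

lemma one_sub_e (z : ℂ) : 1 - e z = e (1 / 2 + z) * (1 - e (-z)) := by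
  rw [e_add, e_half, e_neg, mul_sub, mul_assoc, mul_assoc, mul_inv_cancel₀ (e_ne_zero z)]
  ring

lemma hasSum_of_eq {ι : Type*} {f g : ι → ℂ} {a b : ℂ} (hfg : ∀ i, f i = g i) (hab : a = b)
    (h : HasSum g b) : HasSum f a := by
  rwa [hab, funext hfg]

lemma e_pow_choose_two (τ : ℂ) (k : ℕ) : e τ ^ k.choose 2 = e (k * (k - 1) / 2 * τ) := by
  rw [e_pow, Nat.cast_choose_two]

lemma hasSum_doubleTerm_row {τ u v β : ℂ} (hτ : 0 < τ.im) (huβ : OffLattice τ (u - β))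
    (hA : OffLattice τ (u + v - β - τ)) (r : ℤ) :
    HasSum (doubleTerm τ u v β r) (rowTerm τ u v β r) := by
  have hq := norm_e_lt_one hτ
  have hew : e (u - β + r * τ) * e (v + r * τ) = e (u + v - β - τ + (2 * r + 1) * τ) := by
    rw [← e_add]; ring_nf
  have hC : OffLattice τ (u + v - β - τ + (2 * r + 1) * τ) := by
    simpa using hA.add_int_mul (2 * r + 1)
  have h := (hasSum_gaussTerm (e_ne_zero τ) hq (e := e (u - β + r * τ)) (w := e (v + r * τ))
    (by rw [hew]; exact hC.one_sub_ne_zero)).mul_left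
    ((1 - e (u + v - β - τ + 2 * r * τ)) *
      e (2 * r * (u + v - β - τ) + r * (2 * r - 1) * τ + (r / 2 + r * v + r * (r - 1) / 2 * τ)) *
      qpe τ (u + r * τ) * qpe τ (β - v + (1 - r) * τ) *
      qpe τ (u + v - β - τ + (2 * r + 1) * τ) /
      (thetae τ (u + v - β - τ) * qpe τ (u - β + r * τ)))
  have hC0 := hC.qpe_ne_zero hτ
  have hE0 := (huβ.add_int_mul r).qpe_ne_zero hτ
  refine hasSum_of_eq (fun k => ?_) ?_ h
  · have hk := qpfin_ne_zero (one_sub_mul_pow_self_ne_zero hq) k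
    have hCk := qpfin_ne_zero hC.one_sub_ne_zero k
    have h1 := qpe_eq_qpfin_mul hτ (u + v - β - τ + (2 * r + 1) * τ) k
    have h2 := qpe_eq_qpfin_mul hτ (u - β + r * τ) k
    rw [show u + v - β - τ + (2 * r + 1) * τ + k * τ =
      u + v - β - τ + (2 * r + 1 + k) * τ by ring] at h1
    rw [show u - β + r * τ + k * τ = u - β + (r + k) * τ by ring] at h2
    have h3 : qpe τ (u - β + (r + k) * τ) ≠ 0 := fun h0 => hE0 (by rw [h2, h0, mul_zero])
    have h4 : qpfin (e (u - β + r * τ)) (e τ) k ≠ 0 := fun h0 => hE0 (by rw [h2, h0, zero_mul])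
    have hm : e (2 * r * (u + v - β - τ) + r * (2 * r - 1) * τ + ((r + k) / 2 + (r + k) * v +
        (r + k) * (r + k - 1) / 2 * τ)) =
        e (2 * r * (u + v - β - τ) + r * (2 * r - 1) * τ +
          (r / 2 + r * v + r * (r - 1) / 2 * τ)) *
        ((-e (v + r * τ)) ^ k * e τ ^ k.choose 2) := by
      rw [neg_e, e_pow, e_pow_choose_two, ← e_add, ← e_add]
      ring_nf
    rw [doubleTerm, gaussTerm, hew, hm, h1, h2]
    generalize qpe τ (u - β + (r + k) * τ) = x₁ at h3 ⊢
    generalize qpfin (e (u - β + r * τ)) (e τ) k = x₂ at h4 ⊢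
    generalize qpfin (e (u + v - β - τ + (2 * r + 1) * τ)) (e τ) k = x₃ at hCk ⊢
    field_simp
  · rw [hew, rowTerm, ← qpe, ← qpe]
    generalize qpe τ (u + v - β - τ + (2 * r + 1) * τ) = x₁ at hC0 ⊢
    generalize qpe τ (u - β + r * τ) = x₂ at hE0 ⊢
    field_simp

lemma qpe_sub_nat_mul {τ z : ℂ} (hτ : 0 < τ.im) (hz : OffLattice τ z) (k : ℕ) :
    qpe τ (z - k * τ) =
      e (-k / 2 + k * z - k * (k + 1) / 2 * τ) * qpfin (e (τ - z)) (e τ) k * qpe τ z := by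
  have hz' : OffLattice τ (τ - z + k * τ) := by
    have := hz.neg.add_int_mul (1 + k)
    rwa [show -z + ((1 + k : ℤ) : ℂ) * τ = τ - z + k * τ by push_cast; ring] at this
  have h1 := thetae_add_int_mul hτ z (-k)
  have h2 := qpe_eq_qpfin_mul hτ (τ - z) k
  rw [thetae, thetae, h2, show τ - (z + ((-k : ℤ) : ℂ) * τ) = τ - z + k * τ by push_cast; ring,
    show z + ((-k : ℤ) : ℂ) * τ = z - k * τ by push_cast; ring] at h1
  refine mul_right_cancel₀ (hz'.qpe_ne_zero hτ) (h1.trans ?_)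
  rw [show ((-k : ℤ) : ℂ) / 2 - ((-k : ℤ) : ℂ) * z - ((-k : ℤ) : ℂ) * (((-k : ℤ) : ℂ) - 1) / 2 * τ
    = -k / 2 + k * z - k * (k + 1) / 2 * τ by push_cast; ring]
  ring

lemma hasSum_doubleTerm_column {τ u v β : ℂ} (hτ : 0 < τ.im) (hu : OffLattice τ u)
    (huβ : OffLattice τ (u - β)) (hvβ : OffLattice τ (v - β))
    (hA : OffLattice τ (u + v - β - τ)) (n : ℤ) :
    HasSum (fun k : ℕ => doubleTerm τ u v β (n - k) k) (columnTerm τ u v β n) := by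
  have hq := norm_e_lt_one hτ
  have hcb : e (τ - (u + n * τ)) * e (β - v - n * τ) = e (-(u + v - β - τ) - 2 * n * τ) := by
    rw [← e_add]; ring_nf
  have hbq : e (β - v - n * τ) * e τ = e (β - v + (1 - n) * τ) := by
    rw [← e_add]; ring_nf
  have hB : OffLattice τ (-(u + v - β - τ) - 2 * n * τ) := by
    have := hA.neg.add_int_mul (-2 * n)
    convert this using 1
    push_cast; ring
  have hZ : OffLattice τ (β - v + (1 - n) * τ) := by
    have := hvβ.neg.add_int_mul (1 - n)
    convert this using 1
    push_cast; ring
  have h := (hasSum_wellPoisedTerm (e_ne_zero τ) hq (c := e (τ - (u + n * τ)))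
    (b := e (β - v - n * τ)) (by rw [hbq]; exact hZ.one_sub_ne_zero)).mul_left
    (columnTerm τ u v β n * qpe τ (β - v + (1 - n) * τ) /
      qpe τ (-(u + v - β - τ) - 2 * n * τ))
  have hB0 := hB.qpe_ne_zero hτ
  have hZ0 := hZ.qpe_ne_zero hτ
  have hθ := hA.thetae_ne_zero hτ
  have hE0 := (huβ.add_int_mul n).qpe_ne_zero hτ
  refine hasSum_of_eq (fun k => ?_) ?_ h
  · have hk := qpfin_ne_zero (one_sub_mul_pow_self_ne_zero hq) k
    have hZk := qpfin_ne_zero hZ.one_sub_ne_zero k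
    have hBk := qpfin_ne_zero hB.one_sub_ne_zero k
    have h1 := qpe_sub_nat_mul hτ (hu.add_int_mul n) k
    have h2 := qpe_eq_qpfin_mul hτ (β - v + (1 - n) * τ) k
    have h3 := qpe_eq_qpfin_mul hτ (-(u + v - β - τ) - 2 * n * τ) k
    have h4 := thetae_add_int_mul hτ (u + v - β - τ) (2 * n - k + 1)
    rw [thetae, show τ - (u + v - β - τ + ((2 * n - k + 1 : ℤ) : ℂ) * τ) =
      -(u + v - β - τ) - 2 * n * τ + k * τ by push_cast; ring] at h4
    have h5 : 1 - e (u + v - β - τ + 2 * (n - k) * τ) =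
        e (1 / 2 + (u + v - β - τ) + 2 * (n - k) * τ) *
          (1 - e (-(u + v - β - τ) - 2 * n * τ) * e τ ^ (2 * k)) := by
      rw [e_pow, ← e_add, one_sub_e, ← add_assoc]
      congr 3
      push_cast; ring
    have h6 : qpe τ (-(u + v - β - τ) - 2 * n * τ + k * τ) ≠ 0 := fun h0 =>
      hB0 (by rw [h3, h0, mul_zero])
    have hm : e (1 / 2 + (u + v - β - τ) + 2 * (n - k) * τ) *
        e (2 * (n - k) * (u + v - β - τ) + (n - k) * (2 * (n - k) - 1) * τ +
          (n / 2 + n * v + n * (n - 1) / 2 * τ)) *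
        e (-k / 2 + k * (u + n * τ) - k * (k + 1) / 2 * τ) *
        e (((2 * n - k + 1 : ℤ) : ℂ) / 2 - ((2 * n - k + 1 : ℤ) : ℂ) * (u + v - β - τ) -
          ((2 * n - k + 1 : ℤ) : ℂ) * (((2 * n - k + 1 : ℤ) : ℂ) - 1) / 2 * τ) =
        e (n / 2 + n * v + n * (n - 1) / 2 * τ) *
          (e (β - v + (1 - n) * τ) ^ k * (e τ ^ k.choose 2) ^ 2) := by
      rw [e_pow_choose_two, e_pow, e_pow, ← e_add, ← e_add, ← e_add, ← e_add, ← e_add]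
      refine Eq.trans ?_ ((congrArg (_ * ·) (e_int (n - k + 1))).trans (mul_one _))
      rw [← e_add]
      congr 1
      push_cast; ring
    have h7 := eq_div_of_mul_eq h6 h4
    rw [show u + v - β - τ + ((2 * n - k + 1 : ℤ) : ℂ) * τ =
      u + v - β - τ + (2 * (n - k) + 1 + k) * τ by push_cast; ring] at h7
    rw [show u + n * τ - k * τ = u + (n - k) * τ by ring] at h1
    rw [show β - v + (1 - n) * τ + k * τ = β - v + (1 - (n - k)) * τ by ring] at h2
    have h8 : doubleTerm τ u v β (n - k) k =
        (e (1 / 2 + (u + v - β - τ) + 2 * (n - k) * τ) *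
        e (2 * (n - k) * (u + v - β - τ) + (n - k) * (2 * (n - k) - 1) * τ +
          (n / 2 + n * v + n * (n - 1) / 2 * τ)) *
        e (-k / 2 + k * (u + n * τ) - k * (k + 1) / 2 * τ) *
        e (((2 * n - k + 1 : ℤ) : ℂ) / 2 - ((2 * n - k + 1 : ℤ) : ℂ) * (u + v - β - τ) -
          ((2 * n - k + 1 : ℤ) : ℂ) * (((2 * n - k + 1 : ℤ) : ℂ) - 1) / 2 * τ)) *
        ((1 - e (-(u + v - β - τ) - 2 * n * τ) * e τ ^ (2 * k)) *
          qpfin (e (τ - (u + n * τ))) (e τ) k * qpe τ (u + n * τ) *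
          qpe τ (β - v + (1 - (n - k)) * τ) /
          (qpe τ (-(u + v - β - τ) - 2 * n * τ + k * τ) * qpe τ (u - β + n * τ) *
            qpfin (e τ) (e τ) k)) := by
      rw [doubleTerm, show ((n - k : ℤ) : ℂ) = n - k by push_cast; ring,
        show (n - k + k : ℂ) = n by ring, h5, h1, h7]
      generalize qpe τ (u - β + n * τ) = x₁ at hE0 ⊢
      generalize qpe τ (-(u + v - β - τ) - 2 * n * τ + k * τ) = x₂ at h6 ⊢
      generalize e (1 / 2 + (u + v - β - τ) + 2 * (n - k) * τ) = x₃
      generalize 1 - e (-(u + v - β - τ) - 2 * n * τ) * e τ ^ (2 * k) = x₄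
      field_simp
    rw [h8, hm, columnTerm, wellPoisedTerm, hcb, hbq, h2, h3]
    generalize qpe τ (u - β + n * τ) = x₁ at hE0 ⊢
    generalize qpe τ (-(u + v - β - τ) - 2 * n * τ + k * τ) = x₂ at h6 ⊢
    generalize qpfin (e (β - v + (1 - n) * τ)) (e τ) k = x₃ at hZk ⊢
    generalize qpfin (e (-(u + v - β - τ) - 2 * n * τ)) (e τ) k = x₄ at hBk ⊢
    field_simp
  · rw [hcb, hbq, ← qpe, ← qpe]
    generalize qpe τ (-(u + v - β - τ) - 2 * n * τ) = x₁ at hB0 ⊢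
    generalize qpe τ (β - v + (1 - n) * τ) = x₂ at hZ0 ⊢
    field_simp

/-- `‖f (r, k)‖` is at most `exp (Q (r, k))`, up to a factor growing exponentially in `|r| + k`. -/
def ExpBound (f : ℤ × ℕ → ℂ) (Q : ℤ × ℕ → ℝ) : Prop :=
  ∃ C : ℝ, 0 ≤ C ∧ ∀ p : ℤ × ℕ, ‖f p‖ ≤ Real.exp (C * (1 + |(p.1 : ℝ)| + p.2) + Q p)

lemma ExpBound.mul {f g : ℤ × ℕ → ℂ} {Q R : ℤ × ℕ → ℝ} (hf : ExpBound f Q) (hg : ExpBound g R) :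
    ExpBound (fun p => f p * g p) (fun p => Q p + R p) := by
  obtain ⟨C, hC, hf⟩ := hf
  obtain ⟨D, hD, hg⟩ := hg
  refine ⟨C + D, add_nonneg hC hD, fun p => ?_⟩
  rw [norm_mul]
  refine (mul_le_mul (hf p) (hg p) (norm_nonneg _) (Real.exp_nonneg _)).trans (le_of_eq ?_)
  rw [← Real.exp_add]
  ring_nf

lemma expBound_of_norm_le {f : ℤ × ℕ → ℂ} {M : ℝ} (hM : ∀ p, ‖f p‖ ≤ M) :
    ExpBound f (fun _ => 0) := by
  have h0 : 0 ≤ M := (norm_nonneg _).trans (hM (0, 0))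
  refine ⟨M, h0, fun p => (hM p).trans ?_⟩
  have h1 : M ≤ M * (1 + |(p.1 : ℝ)| + p.2) :=
    le_mul_of_one_le_right h0 (by linarith [abs_nonneg (p.1 : ℝ), p.2.cast_nonneg (α := ℝ)])
  linarith [Real.add_one_le_exp (M * (1 + |(p.1 : ℝ)| + p.2) + 0)]

lemma expBound_qpe {τ : ℂ} (hτ : 0 < τ.im) (z : ℂ) (n : ℤ × ℕ → ℤ)
    (hn : ∀ p, |(n p : ℝ)| ≤ 2 * (|(p.1 : ℝ)| + p.2)) :
    ExpBound (fun p => qpe τ (z + n p * τ))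
      (fun p => 2 * Real.pi * τ.im * ((min (n p : ℝ) 0) ^ 2 / 2)) := by
  obtain ⟨C, hC, h⟩ := exists_qpe_bound hτ z
  refine ⟨2 * C, by positivity, fun p => (h (n p)).trans ?_⟩
  rw [Real.exp_le_exp]
  have := mul_le_mul_of_nonneg_left (hn p) hC
  linarith

lemma expBound_e {f : ℤ × ℕ → ℂ} {Q : ℤ × ℕ → ℝ} {A B D : ℝ}
    (h : ∀ p, -(2 * Real.pi) * (f p).im = A * p.1 + B * p.2 + D + Q p) :
    ExpBound (fun p => e (f p)) Q := by
  refine ⟨|A| + |B| + |D|, by positivity, fun p => ?_⟩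
  rw [norm_e, h, Real.exp_le_exp]
  have h0 := p.2.cast_nonneg (α := ℝ)
  have h1 := (le_abs_self _).trans (abs_mul A p.1).le
  have h2 := mul_le_mul_of_nonneg_right (le_abs_self B) h0
  have h3 := mul_nonneg (abs_nonneg A) h0
  have h4 := mul_nonneg (abs_nonneg B) (abs_nonneg (p.1 : ℝ))
  have h5 := mul_nonneg (abs_nonneg D) (add_nonneg (abs_nonneg (p.1 : ℝ)) h0)
  linarith [abs_nonneg A, abs_nonneg B, le_abs_self D]

lemma ExpBound.one_sub {f : ℤ × ℕ → ℂ} (hf : ExpBound f (fun _ => 0)) :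
    ExpBound (fun p => 1 - f p) (fun _ => 0) := by
  obtain ⟨C, hC, hf⟩ := hf
  refine ⟨C + 1, by positivity, fun p => (norm_sub_le _ _).trans ?_⟩
  have h1 : 1 ≤ 1 + |(p.1 : ℝ)| + p.2 := by
    linarith [abs_nonneg (p.1 : ℝ), p.2.cast_nonneg (α := ℝ)]
  have h2 := hf p
  generalize 1 + |(p.1 : ℝ)| + (p.2 : ℝ) = x at h1 h2 ⊢
  have h3 : 1 ≤ Real.exp (C * x + 0) := Real.one_le_exp (by nlinarith)
  rw [norm_one, show (C + 1) * x + 0 = x + (C * x + 0) by ring, Real.exp_add x]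
  nlinarith [Real.add_one_le_exp x]

lemma doubleTerm_quadratic_bound {r k : ℝ} (hk : 0 ≤ k) :
    (r ^ 2 + k ^ 2) / 20 ≤ 2 * r ^ 2 + (r + k) ^ 2 - ((min r 0) ^ 2 / 2 + (min (-r) 0) ^ 2 / 2 +
      (min (2 * r + k) 0) ^ 2 / 2 + (min (-(r + k)) 0) ^ 2 / 2) := by
  rcases le_total r 0 with hr | hr
  · rw [min_eq_left hr, min_eq_right (by linarith : 0 ≤ -r)]
    rcases le_total (2 * r + k) 0 with h1 | h1
    · rw [min_eq_left h1]
      rcases le_total (r + k) 0 with h2 | h2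
      · rw [min_eq_right (by linarith)]
        nlinarith [sq_nonneg r, sq_nonneg k]
      · rw [min_eq_left (by linarith)]
        nlinarith [mul_nonneg hk (by linarith : 0 ≤ -r), mul_nonneg h2 (by linarith : 0 ≤ -r),
          mul_nonneg hk (by linarith : 0 ≤ -(2 * r + k))]
    · rw [min_eq_right h1, min_eq_left (by linarith)]
      nlinarith [sq_nonneg (r + k), sq_nonneg r, sq_nonneg (2 * r + k)]
  · rw [min_eq_right hr, min_eq_left (by linarith : -r ≤ 0), min_eq_right (by linarith),
      min_eq_left (by linarith)]
    nlinarith [mul_nonneg hr hk, sq_nonneg r, sq_nonneg k]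

lemma summable_exp_linear_sub_sq (C : ℝ) {δ : ℝ} (hδ : 0 < δ) :
    Summable fun n : ℕ => Real.exp (C * n - δ * (n : ℝ) ^ 2) := by
  refine Summable.of_nonneg_of_le (fun _ => Real.exp_nonneg _) (fun n => ?_)
    (Real.summable_exp_neg_nat.mul_left (Real.exp ((C + 1) ^ 2 / (4 * δ))))
  rw [← Real.exp_add, Real.exp_le_exp]
  have h : (C + 1) * n - δ * (n : ℝ) ^ 2 ≤ (C + 1) ^ 2 / (4 * δ) := by
    rw [le_div_iff₀ (by positivity)]
    nlinarith [sq_nonneg (2 * δ * n - (C + 1))]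
  linarith

lemma ExpBound.summable {f : ℤ × ℕ → ℂ} {Q : ℤ × ℕ → ℝ} {δ : ℝ} (hδ : 0 < δ) (hf : ExpBound f Q)
    (hQ : ∀ p, Q p ≤ -(δ * ((p.1 : ℝ) ^ 2 + (p.2 : ℝ) ^ 2))) : Summable f := by
  obtain ⟨C, -, hf⟩ := hf
  have h1 := summable_exp_linear_sub_sq C hδ
  have h2 : Summable fun n : ℤ => Real.exp (C * |(n : ℝ)| - δ * (n : ℝ) ^ 2) :=
    Summable.of_nat_of_neg (by simpa using h1) (by simpa using h1)
  refine Summable.of_norm_bounded ((h2.mul_of_nonneg h1 (fun _ => Real.exp_nonneg _)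
    fun _ => Real.exp_nonneg _).mul_left (Real.exp C)) fun p => (hf p).trans ?_
  rw [← Real.exp_add, ← Real.exp_add, Real.exp_le_exp]
  linarith [hQ p]

lemma doubleTerm_eq {τ u v β : ℂ} (hτ : 0 < τ.im) (huβ : OffLattice τ (u - β)) (r : ℤ) (k : ℕ) :
    doubleTerm τ u v β r k =
      (1 - e (u + v - β - τ + 2 * r * τ)) *
      (e (2 * r * (u + v - β - τ) + r * (2 * r - 1) * τ + (r + k) * (u + v - β) +
        (r + k) * (r + k - 1) * τ) *
      (qpe τ (u + r * τ) * (qpe τ (β - v + τ + (-r : ℤ) * τ) *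
      (qpe τ (u + v - β - τ + τ + (2 * r + k : ℤ) * τ) *
      (qpe τ (τ - (u - β) + (-(r + k) : ℤ) * τ) *
      ((qpfin (e τ) (e τ) k)⁻¹ * (thetae τ (u + v - β - τ) * thetae τ (u - β))⁻¹)))))) := by
  have h := thetae_add_int_mul hτ (u - β) (r + k)
  have hN := huβ.add_int_mul (r + k)
  have h0 := hN.qpe_ne_zero hτ
  have hθ := huβ.thetae_ne_zero hτ
  have hm : e (2 * r * (u + v - β - τ) + r * (2 * r - 1) * τ + ((r + k) / 2 + (r + k) * v +
      (r + k) * (r + k - 1) / 2 * τ)) =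
      e (2 * r * (u + v - β - τ) + r * (2 * r - 1) * τ + (r + k) * (u + v - β) +
        (r + k) * (r + k - 1) * τ) *
      e (((r + k : ℤ) : ℂ) / 2 - ((r + k : ℤ) : ℂ) * (u - β) -
        ((r + k : ℤ) : ℂ) * (((r + k : ℤ) : ℂ) - 1) / 2 * τ) := by
    rw [← e_add]
    congr 1
    push_cast; ring
  rw [thetae, show τ - (u - β + ((r + k : ℤ) : ℂ) * τ) = τ - (u - β) + (-(r + k) : ℤ) * τ by
    push_cast; ring] at h
  rw [doubleTerm, hm, show β - v + (1 - r) * τ = β - v + τ + (-r : ℤ) * τ by push_cast; ring,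
    show u + v - β - τ + (2 * r + 1 + k) * τ = u + v - β - τ + τ + (2 * r + k : ℤ) * τ by
      push_cast; ring,
    show u - β + ((r : ℂ) + k) * τ = u - β + ((r + k : ℤ) : ℂ) * τ by push_cast; ring]
  generalize qpe τ (u - β + ((r + k : ℤ) : ℂ) * τ) = x₁ at h h0 ⊢
  generalize e (((r + k : ℤ) : ℂ) / 2 - ((r + k : ℤ) : ℂ) * (u - β) -
        ((r + k : ℤ) : ℂ) * (((r + k : ℤ) : ℂ) - 1) / 2 * τ) = x₂ at h ⊢
  generalize qpe τ (τ - (u - β) + (-(r + k) : ℤ) * τ) = x₃ at h ⊢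
  generalize thetae τ (u - β) = x₄ at h hθ ⊢
  generalize thetae τ (u + v - β - τ) = x₅
  generalize qpfin (e τ) (e τ) k = x₆
  obtain rfl : x₂ = x₁ * x₃ / x₄ := by rw [h, mul_div_cancel_right₀ _ hθ]
  field_simp

lemma summable_doubleTerm {τ u v β : ℂ} (hτ : 0 < τ.im) (huβ : OffLattice τ (u - β)) :
    Summable fun p : ℤ × ℕ => doubleTerm τ u v β p.1 p.2 := by
  have hq := norm_e_lt_one hτ
  have hl := mul_pos Real.two_pi_pos hτ
  obtain ⟨M, -, hM⟩ := qpfin_inv_bounded hq (one_sub_mul_pow_self_ne_zero hq)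
  simp only [doubleTerm_eq hτ huβ]
  refine ExpBound.summable (δ := 2 * Real.pi * τ.im / 20) (by positivity)
    ((expBound_e (A := -(2 * Real.pi) * (2 * τ.im)) (B := 0)
      (D := -(2 * Real.pi) * (u + v - β - τ).im) (Q := fun _ => 0) fun p => ?_).one_sub.mul <|
    (expBound_e (A := -(2 * Real.pi) * (2 * (u + v - β - τ).im - τ.im + (u + v - β).im - τ.im))
      (B := -(2 * Real.pi) * ((u + v - β).im - τ.im)) (D := 0)
      (Q := fun p => -(2 * Real.pi * τ.im) * (2 * (p.1 : ℝ) ^ 2 + (p.1 + p.2 : ℝ) ^ 2))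
      fun p => ?_).mul <|
    (expBound_qpe hτ u (fun p => p.1) fun p => ?_).mul <|
    (expBound_qpe hτ _ (fun p => -p.1) fun p => ?_).mul <|
    (expBound_qpe hτ _ (fun p => 2 * p.1 + p.2) fun p => ?_).mul <|
    (expBound_qpe hτ _ (fun p => -(p.1 + p.2)) fun p => ?_).mul <|
    (expBound_of_norm_le fun p => hM p.2).mul (expBound_of_norm_le fun _ => le_rfl)) fun p => ?_
  · simp [Complex.mul_im, Complex.mul_re]
    ring
  · simp [Complex.mul_im, Complex.mul_re]
    ring
  · linarith [abs_nonneg (p.1 : ℝ), p.2.cast_nonneg (α := ℝ)]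
  · push_cast
    rw [abs_neg]
    linarith [abs_nonneg (p.1 : ℝ), p.2.cast_nonneg (α := ℝ)]
  · push_cast
    refine (abs_add_le _ _).trans ?_
    rw [abs_mul, abs_two, Nat.abs_cast]
    linarith [p.2.cast_nonneg (α := ℝ)]
  · push_cast
    rw [abs_neg]
    refine (abs_add_le _ _).trans ?_
    rw [Nat.abs_cast]
    linarith [abs_nonneg (p.1 : ℝ), p.2.cast_nonneg (α := ℝ)]
  · have h := mul_le_mul_of_nonneg_left
      (doubleTerm_quadratic_bound (r := p.1) (p.2.cast_nonneg (α := ℝ))) hl.le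
    push_cast
    linarith

/-- The shear `(n, k) ↦ (n - k, k)` of `ℤ × ℕ`. -/
def subShear : ℤ × ℕ ≃ ℤ × ℕ where
  toFun p := (p.1 - p.2, p.2)
  invFun p := (p.1 + p.2, p.2)
  left_inv p := by simp
  right_inv p := by simp

lemma exists_hasSum_rowTerm_columnTerm {τ u v β : ℂ} (hτ : 0 < τ.im) (hu : OffLattice τ u)
    (huβ : OffLattice τ (u - β)) (hvβ : OffLattice τ (v - β))
    (hA : OffLattice τ (u + v - β - τ)) :
    ∃ S, HasSum (rowTerm τ u v β) S ∧ HasSum (columnTerm τ u v β) S := by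
  obtain ⟨S, hS⟩ := summable_doubleTerm (v := v) hτ huβ
  refine ⟨S, hS.prod_fiberwise (hasSum_doubleTerm_row hτ huβ hA), ?_⟩
  exact (subShear.hasSum_iff.mpr hS).prod_fiberwise (hasSum_doubleTerm_column hτ hu huβ hvβ hA)

lemma qpint_e (τ z : ℂ) (n : ℤ) : qpint (e z) (e τ) n = qpe τ z / qpe τ (z + n * τ) := by
  rw [qpint, e_zpow, ← e_add, qpe, qpe]

lemma qtheta_e (τ z : ℂ) : qtheta (e τ) (e z) = thetae τ z := by
  rw [qtheta, ← e_sub, thetae, qpe, qpe]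

lemma OffLattice.qpe_reflect_ne_zero {τ u β : ℂ} (hτ : 0 < τ.im) (h : OffLattice τ (u - β)) :
    qpe τ (β + τ - u) ≠ 0 := by
  rw [show β + τ - u = τ - (u - β) by ring]
  exact right_ne_zero_of_mul (h.thetae_ne_zero hτ)

lemma offLattice_of_ne_zpow {τ z : ℂ} (h : ∀ m : ℤ, e z ≠ e τ ^ m) : OffLattice τ z :=
  fun n hn => h (-n) (by
    rw [e_zpow, ← mul_one (e (((-n : ℤ) : ℂ) * τ)), ← hn, ← e_add]
    congr 1
    push_cast; ring)

lemma rowTerm_eq {τ u v β : ℂ} (hτ : 0 < τ.im) (hu : OffLattice τ u) (hv : OffLattice τ v)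
    (huβ : OffLattice τ (u - β)) (hvβ : OffLattice τ (v - β)) (r : ℤ) :
    rowTerm τ u v β r = qpe τ u * qpe τ v * qpe τ (β + τ - u) * qpe τ (β + τ - v) /
        (thetae τ (u - β) * thetae τ (u + v - β - τ)) *
      ((1 - e (u + v - β) * e τ ^ (2 * r - 1)) *
        (qpint (e (u - β)) (e τ) r * qpint (e (v - β)) (e τ) r /
          (qpint (e u) (e τ) r * qpint (e v) (e τ) r)) *
        e τ ^ (2 * r ^ 2 - 3 * r) * e (2 * u + 2 * v - β) ^ r) := by
  have hu0 := hu.qpe_ne_zero hτ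
  have hv0 := hv.qpe_ne_zero hτ
  have hur := (hu.add_int_mul r).qpe_ne_zero hτ
  have hvr := (hv.add_int_mul r).qpe_ne_zero hτ
  have huβr := (huβ.add_int_mul r).qpe_ne_zero hτ
  have hvβr := (hvβ.add_int_mul r).qpe_ne_zero hτ
  have hθ := huβ.thetae_ne_zero hτ
  have h1 := thetae_add_int_mul hτ (v - β) r
  rw [thetae, thetae, show τ - (v - β + r * τ) = β - v + (1 - r) * τ by ring,
    show τ - (v - β) = β + τ - v by ring] at h1
  have hθu : thetae τ (u - β) = qpe τ (u - β) * qpe τ (β + τ - u) := by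
    rw [thetae, show τ - (u - β) = β + τ - u by ring]
  rw [hθu] at hθ
  have hm : e τ ^ (2 * r ^ 2 - 3 * r) * e (2 * u + 2 * v - β) ^ r =
      e (r / 2 - r * (v - β) - r * (r - 1) / 2 * τ) *
      e (2 * r * (u + v - β - τ) + r * (2 * r - 1) * τ + (r / 2 + r * v + r * (r - 1) / 2 * τ)) := by
    rw [e_zpow, e_zpow, ← e_add, ← e_add]
    refine ((congrArg (_ * ·) (e_int r)).trans (mul_one _)).symm.trans ?_
    rw [← e_add]
    congr 1
    push_cast; ring
  have h2 : e (u + v - β) * e τ ^ (2 * r - 1) = e (u + v - β - τ + 2 * r * τ) := by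
    rw [e_zpow, ← e_add]
    congr 1
    push_cast; ring
  rw [rowTerm, mul_assoc _ (e τ ^ (2 * r ^ 2 - 3 * r)), hm, h2, qpint_e, qpint_e, qpint_e, qpint_e,
    hθu]
  have h3 : qpe τ (β - v + (1 - r) * τ) = e (r / 2 - r * (v - β) - r * (r - 1) / 2 * τ) *
      (qpe τ (v - β) * qpe τ (β + τ - v)) / qpe τ (v - β + r * τ) := by
    rw [← h1, mul_div_cancel_left₀ _ hvβr]
  rw [h3]
  generalize qpe τ u = x₁ at *
  generalize qpe τ v = x₂ at *
  generalize qpe τ (u + r * τ) = x₃ at *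
  generalize qpe τ (v + r * τ) = x₄ at *
  generalize qpe τ (u - β + r * τ) = x₅ at *
  generalize qpe τ (v - β + r * τ) = x₆ at *
  generalize qpe τ (u - β) = x₇ at *
  generalize qpe τ (β + τ - u) = x₈ at *
  obtain ⟨h7, h8⟩ := mul_ne_zero_iff.mp hθ
  generalize e (u + v - β - τ + 2 * r * τ) = x₉
  field_simp

lemma genMu_eq (τ u v α : ℂ) :
    genMu τ u v α = -Complex.I * e (-τ / 8) * e (α * (u - v) / 2) /
      (qpe τ τ * thetae τ v) * ∑' n : ℤ, columnTerm τ u v (α * τ) n := by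
  have hterm : ∀ n : ℤ, (-1 : ℂ) ^ n * e (((n : ℂ) + 1 / 2) * v) * (e τ) ^ ((n * (n + 1)) / 2) *
      (qpinf (e u * (e τ) ^ (n + 1)) (e τ) /
       qpinf (e u * e (τ * ((n : ℂ) - α + 1))) (e τ)) =
      -e (-v / 2) * columnTerm τ u v (α * τ) (Equiv.addRight 1 n) := fun n => by
    obtain ⟨m, hm⟩ := (Int.even_mul_succ_self n).two_dvd
    have hm' : (m : ℂ) = n * (n + 1) / 2 := by
      rw [eq_div_iff two_ne_zero]
      exact_mod_cast (by linarith : m * 2 = n * (n + 1))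
    rw [hm, Int.mul_ediv_cancel_left _ two_ne_zero, columnTerm, neg_one_zpow_eq_e, e_zpow, e_zpow,
      ← e_add, ← e_add, ← e_add, ← e_add, neg_e, mul_div_assoc, ← mul_assoc, ← e_add, qpe, qpe, hm']
    congr 1
    · refine ((congrArg (_ * ·) (e_int 1)).trans (mul_one _)).symm.trans ?_
      rw [← e_add]
      congr 1
      simp only [Equiv.coe_addRight]
      push_cast; ring
    · simp only [Equiv.coe_addRight]
      congr 3
      push_cast; ring
  rw [genMu, tsum_congr hterm, tsum_mul_left, (Equiv.addRight (1 : ℤ)).tsum_eq, theta11, qtheta_e,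
    ← qpe, show -τ / 8 = -(τ / 8) by ring, e_neg (τ / 8)]
  have h1 := e_ne_zero (τ / 8)
  have h2 := e_ne_zero (-v / 2)
  have h3 := Complex.I_ne_zero
  generalize e (τ / 8) = x₁ at *
  generalize e (-v / 2) = x₂ at *
  generalize e (α * (u - v) / 2) = x₃ at *
  field_simp
  linear_combination (x₃ * (∑' n : ℤ, columnTerm τ u v (α * τ) n) / (qpe τ τ * thetae τ v)) *
    Complex.I_sq

theorem stmt3 (τ u v α : ℂ) (hτ : 0 < τ.im)
    (hu : ∀ m n : ℤ, u ≠ (m : ℂ) + (n : ℂ) * τ)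
    (hv : ∀ m n : ℤ, v ≠ (m : ℂ) + (n : ℂ) * τ)
    (q x y a : ℂ)
    (hq : q = e τ) (hx : x = e u) (hy : y = e v) (ha : a = e (α * τ))
    (h1 : ∀ m : ℤ, x ≠ q ^ m)
    (h2 : ∀ m : ℤ, y ≠ q ^ m)
    (h3 : ∀ m : ℤ, x / a ≠ q ^ m)
    (h4 : ∀ m : ℤ, y / a ≠ q ^ m)
    (h5 : ∀ m : ℤ, x * y / (a * q) ≠ q ^ m) :
    Summable (fun n : ℤ =>
      ‖(1 - (x * y / a) * q ^ (2 * n - 1)) *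
          (qpint (x / a) q n * qpint (y / a) q n / (qpint x q n * qpint y q n)) *
          q ^ (2 * n ^ 2 - 3 * n) * (x ^ 2 * y ^ 2 / a) ^ n‖) ∧
    genMu τ u v α =
      - Complex.I * e (-τ / 8) * e (α * (u - v) / 2) *
        (qpinf x q * qpinf y q * qpinf (a * q / x) q * qpinf (a * q / y) q) /
        (qpinf q q * qtheta q y * qtheta q (x / a) * qtheta q (x * y / (a * q))) *
        ∑' n : ℤ, (1 - (x * y / a) * q ^ (2 * n - 1)) *
          (qpint (x / a) q n * qpint (y / a) q n / (qpint x q n * qpint y q n)) *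
          q ^ (2 * n ^ 2 - 3 * n) * (x ^ 2 * y ^ 2 / a) ^ n := by
  have hu' : OffLattice τ u := offLattice_of_ne_zpow (by simpa only [hx, hq] using h1)
  have hv' : OffLattice τ v := offLattice_of_ne_zpow (by simpa only [hy, hq] using h2)
  have hxa : x / a = e (u - α * τ) := by rw [hx, ha, e_sub]
  have hya : y / a = e (v - α * τ) := by rw [hy, ha, e_sub]
  have hax : a * q / x = e (α * τ + τ - u) := by rw [hx, ha, hq, e_sub, e_add]
  have hay : a * q / y = e (α * τ + τ - v) := by rw [hy, ha, hq, e_sub, e_add]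
  have hxy : x * y / a = e (u + v - α * τ) := by rw [hx, hy, ha, e_sub, e_add]
  have hxyq : x * y / (a * q) = e (u + v - α * τ - τ) := by
    rw [hx, hy, ha, hq, e_sub, e_sub, e_add, div_div]
  have hxy2 : x ^ 2 * y ^ 2 / a = e (2 * u + 2 * v - α * τ) := by
    rw [hx, hy, ha, e_sub, e_add, e_pow, e_pow, Nat.cast_ofNat]
  rw [hxa, hq] at h3
  rw [hya, hq] at h4
  rw [hxyq, hq] at h5
  have huβ := offLattice_of_ne_zpow h3
  have hvβ := offLattice_of_ne_zpow h4
  have hA := offLattice_of_ne_zpow h5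
  obtain ⟨S, hrow, hcol⟩ := exists_hasSum_rowTerm_columnTerm hτ hu' huβ hvβ hA
  simp only [hxa, hya, hax, hay, hxy, hxyq, hxy2]
  rw [hq, hx, hy, genMu_eq, hcol.tsum_eq, qtheta_e, qtheta_e, qtheta_e]
  rw [funext (rowTerm_eq hτ hu' hv' huβ hvβ)] at hrow
  refine ⟨((summable_mul_left_iff ?_).mp hrow.summable).norm, ?_⟩
  · exact div_ne_zero (mul_ne_zero (mul_ne_zero (mul_ne_zero (hu'.qpe_ne_zero hτ)
      (hv'.qpe_ne_zero hτ)) (huβ.qpe_reflect_ne_zero hτ)) (hvβ.qpe_reflect_ne_zero hτ))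
      (mul_ne_zero (huβ.thetae_ne_zero hτ) (hA.thetae_ne_zero hτ))
  rw [← hrow.tsum_eq, tsum_mul_left]
  simp only [qpe]
  ring
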